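/- arXiv:math-ph/0703028 — 2 statements merged into one kernel-verified Lean document; each statement's English description precedes it below -/
import Mathlib

section
/- (The classically allowed intervals are zero lines for the full eigenvalue sequence of a double well.) Let a₀ < a₁ < a₂ < a₃ be real numbers and q(z) = (z−a₀)(z−a₁)(z−a₂)(z−a₃). Let (λ_n) be any sequence of positive reals with λ_n → ∞ such that each λ_n is an eigenvalue of q with eigenfunction y_n. Then for every compact set K ⊆ (a₀,a₁) ∪ (a₂,a₃) (a compact subset of the real line) there exists an open neighborhood V of K in ℂ such that for every continuous φ : ℂ → ℝ with compact support contained in V: (1/λ_n) Σ_{z ∈ ℂ, y_n(z)=0} φ(z) → (1/π) ∫_{(a₀,a₁) ∪ (a₂,a₃)} φ(x) √|q(x)| dx. -/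
open MeasureTheory Filter Topology

/-- The normalized sum of `φ` over the zeros of `y`. -/
noncomputable def zeroSum (y : ℂ → ℂ) (φ : ℂ → ℝ) : ℝ :=
  ∑' z : {z : ℂ // y z = 0}, φ (z : ℂ)

/-- `lam` is an eigenvalue of the potential `q` with eigenfunction `y`. -/
def IsEigen (q : ℂ → ℂ) (lam : ℝ) (y : ℂ → ℂ) : Prop :=
  0 < lam ∧ Differentiable ℂ y ∧ (∃ z, y z ≠ 0) ∧
    (∀ z : ℂ, deriv (deriv y) z = (lam : ℂ) ^ 2 * q z * y z) ∧
    Integrable (fun x : ℝ => ‖y (x : ℂ)‖ ^ 2)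

/-- Sturm lower bound: a zero in each half-open interval of length `π / m`. -/
lemma sturm_exists_zero (f f' P : ℝ → ℝ) (hf : ∀ x, HasDerivAt f (f' x) x)
    (hf' : ∀ x, HasDerivAt f' (-(P x) * f x) x) (m s : ℝ) (hm : 0 < m)
    (hP : ∀ x ∈ Set.Ico s (s + Real.pi / m), m ^ 2 ≤ P x) :
    ∃ x ∈ Set.Ico s (s + Real.pi / m), f x = 0 := by
  have hpm : 0 < Real.pi / m := div_pos Real.pi_pos hm
  -- positive case
  have key : ∀ g g' : ℝ → ℝ, (∀ x, HasDerivAt g (g' x) x) →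
      (∀ x, HasDerivAt g' (-(P x) * g x) x) →
      (∀ x ∈ Set.Ico s (s + Real.pi / m), 0 < g x) → False := by
    intro g g' hg hg' hpos
    set t := s + Real.pi / m with ht
    have hst : s < t := by linarith
    set W : ℝ → ℝ := fun x => g' x * Real.sin (m * (x - s)) - g x * (m * Real.cos (m * (x - s)))
    have hlin : ∀ x, HasDerivAt (fun x : ℝ => m * (x - s)) m x := fun x => by
      simpa using ((hasDerivAt_id x).sub_const s).const_mul m
    have hW : ∀ x, HasDerivAt W ((m ^ 2 - P x) * g x * Real.sin (m * (x - s))) x := by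
      intro x
      have h1 := (hg' x).mul ((hlin x).sin)
      have h2 := (hg x).mul (((hlin x).cos).const_mul m)
      refine (h1.sub h2).congr_deriv ?_
      ring
    have hanti : AntitoneOn W (Set.Icc s t) := by
      apply antitoneOn_of_deriv_nonpos (convex_Icc s t)
      · exact fun x _ => (hW x).continuousAt.continuousWithinAt
      · exact fun x _ => (hW x).differentiableAt.differentiableWithinAt
      · intro x hx
        rw [interior_Icc] at hx
        rw [(hW x).deriv]
        have hxm : x ∈ Set.Ico s t := ⟨hx.1.le, hx.2⟩
        have h1 := hP x hxm
        have h2 := hpos x hxm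
        have h3 : 0 ≤ Real.sin (m * (x - s)) := by
          apply Real.sin_nonneg_of_nonneg_of_le_pi
          · exact mul_nonneg hm.le (by linarith [hx.1])
          · have : x - s ≤ Real.pi / m := by linarith [hx.2]
            calc m * (x - s) ≤ m * (Real.pi / m) := by gcongr
              _ = Real.pi := by field_simp
        have : (m ^ 2 - P x) * g x ≤ 0 := mul_nonpos_of_nonpos_of_nonneg (by linarith) h2.le
        exact mul_nonpos_of_nonpos_of_nonneg this h3
    have hle := hanti (Set.left_mem_Icc.2 hst.le) (Set.right_mem_Icc.2 hst.le) hst.le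
    have hWs : W s = -(g s * m) := by simp [W]
    have hWt : W t = g t * m := by
      have : m * (t - s) = Real.pi := by rw [ht]; field_simp; ring
      simp [W, this]
    have hgt : 0 ≤ g t := by
      have hc : ContinuousWithinAt g (Set.Ico s t) t := (hg t).continuousAt.continuousWithinAt
      have hne : (𝓝[Set.Ico s t] t).NeBot := by
        rw [← mem_closure_iff_nhdsWithin_neBot, closure_Ico hst.ne]
        exact Set.right_mem_Icc.2 hst.le
      exact ge_of_tendsto hc (eventually_mem_nhdsWithin.mono fun x hx => (hpos x hx).le)
    have hgs := hpos s ⟨le_rfl, hst⟩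
    rw [hWs, hWt] at hle
    nlinarith [mul_pos hgs hm, mul_nonneg hgt hm.le]
  by_contra hcon
  push Not at hcon
  have hcont : Continuous f := continuous_iff_continuousAt.2 fun x => (hf x).continuousAt
  have hs : s ∈ Set.Ico s (s + Real.pi / m) := ⟨le_rfl, by linarith⟩
  rcases lt_or_gt_of_ne (hcon s hs) with h | h
  · refine key (fun x => - f x) (fun x => - f' x) (fun x => (hf x).neg)
      (fun x => ((hf' x).neg).congr_deriv (by ring)) ?_
    intro x hx
    by_contra hx0
    have hx0 : 0 ≤ f x := by simpa using hx0
    obtain ⟨z, hz, hz0⟩ := intermediate_value_Icc hx.1 hcont.continuousOn ⟨h.le, hx0⟩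
    exact hcon z ⟨hz.1, hz.2.trans_lt hx.2⟩ hz0
  · refine key f f' hf hf' ?_
    intro x hx
    by_contra hx0
    have hx0 : f x ≤ 0 := by simpa using hx0
    obtain ⟨z, hz, hz0⟩ := intermediate_value_Icc' hx.1 hcont.continuousOn ⟨hx0, h.le⟩
    exact hcon z ⟨hz.1, hz.2.trans_lt hx.2⟩ hz0

/-- Sturm upper bound: distinct zeros are separated by at least `π / M`. -/
lemma sturm_gap (f f' P : ℝ → ℝ) (hf : ∀ x, HasDerivAt f (f' x) x)
    (hf' : ∀ x, HasDerivAt f' (-(P x) * f x) x)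
    (hne : ∀ s t, s < t → ∃ x ∈ Set.Ioo s t, f x ≠ 0) (M α β : ℝ) (hM : 0 < M)
    (hαβ : α < β) (hP : ∀ x ∈ Set.Ioo α β, P x < M ^ 2) (hα : f α = 0) (hβ : f β = 0) :
    Real.pi / M ≤ β - α := by
  by_contra hlt
  push Not at hlt
  set c := (α + β) / 2 with hc
  have hcos : ∀ x ∈ Set.Icc α β, 0 < Real.cos (M * (x - c)) := by
    intro x hx
    have hMl : M * (β - α) < Real.pi := by
      rw [lt_div_iff₀ hM] at hlt; linarith
    apply Real.cos_pos_of_mem_Ioo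
    constructor
    · have : M * (α - c) ≤ M * (x - c) := by gcongr; exact hx.1
      have h2 : M * (α - c) = -(M * (β - α)) / 2 := by rw [hc]; ring
      linarith
    · have : M * (x - c) ≤ M * (β - c) := by gcongr; exact hx.2
      have h2 : M * (β - c) = (M * (β - α)) / 2 := by rw [hc]; ring
      linarith
  set F : ℝ → ℝ := fun x =>
    f x * f' x + f x ^ 2 * (M * Real.sin (M * (x - c)) / Real.cos (M * (x - c)))
  have hlin : ∀ x, HasDerivAt (fun x : ℝ => M * (x - c)) M x := fun x => by
    simpa using ((hasDerivAt_id x).sub_const c).const_mul M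
  have hF : ∀ x ∈ Set.Icc α β, HasDerivAt F
      ((f' x + f x * (M * Real.sin (M * (x - c)) / Real.cos (M * (x - c)))) ^ 2
        + (M ^ 2 - P x) * f x ^ 2) x := by
    intro x hx
    have hcx := (hcos x hx).ne'
    have h1 := (hf x).mul (hf' x)
    have h2 := ((hf x).pow 2).mul ((((hlin x).sin).const_mul M).div ((hlin x).cos) hcx)
    refine (h1.add h2).congr_deriv ?_
    simp only [Pi.pow_apply, Pi.div_apply]
    field_simp
    ring
  have hmono : MonotoneOn F (Set.Icc α β) := by
    apply monotoneOn_of_deriv_nonneg (convex_Icc α β)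
    · exact fun x hx => (hF x hx).continuousAt.continuousWithinAt
    · intro x hx
      rw [interior_Icc] at hx
      exact (hF x (Set.Ioo_subset_Icc_self hx)).differentiableAt.differentiableWithinAt
    · intro x hx
      rw [interior_Icc] at hx
      rw [(hF x (Set.Ioo_subset_Icc_self hx)).deriv]
      have := hP x hx
      have h3 : 0 ≤ M ^ 2 - P x := by linarith
      positivity
  have hFα : F α = 0 := by simp [F, hα]
  have hFβ : F β = 0 := by simp [F, hβ]
  have hF0 : ∀ x ∈ Set.Icc α β, F x = 0 := by
    intro x hx
    apply le_antisymm
    · rw [← hFβ]; exact hmono hx (Set.right_mem_Icc.2 hαβ.le) hx.2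
    · rw [← hFα]; exact hmono (Set.left_mem_Icc.2 hαβ.le) hx hx.1
  obtain ⟨x, hx, hfx⟩ := hne α β hαβ
  have hd := hF x (Set.Ioo_subset_Icc_self hx)
  have hev : F =ᶠ[𝓝 x] fun _ => 0 := by
    filter_upwards [Ioo_mem_nhds hx.1 hx.2] with z hz
    exact hF0 z (Set.Ioo_subset_Icc_self hz)
  have h0 := hd.unique ((hasDerivAt_const x (0 : ℝ)).congr_of_eventuallyEq hev)
  have h3 : 0 < (M ^ 2 - P x) * f x ^ 2 :=
    mul_pos (by linarith [hP x hx]) (by positivity)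
  nlinarith [sq_nonneg (f' x + f x * (M * Real.sin (M * (x - c)) / Real.cos (M * (x - c))))]

/-- A separated finite subset of `[s,t)` has few elements. -/
lemma separated_card (F : Finset ℝ) (s t δ : ℝ) (hδ : 0 < δ) (hst : s ≤ t)
    (hF : ∀ x ∈ F, x ∈ Set.Ico s t)
    (hsep : ∀ x ∈ F, ∀ z ∈ F, x < z → δ ≤ z - x) : (F.card : ℝ) ≤ (t - s) / δ + 1 := by
  have hcard : F.card ≤ (Finset.range (⌊(t - s) / δ⌋₊ + 1)).card := by
    apply Finset.card_le_card_of_injOn (fun x => ⌊(x - s) / δ⌋₊)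
    · intro x hx
      have := hF x hx
      simp only [Finset.coe_range, Set.mem_Iio]
      apply Nat.lt_succ_of_le
      apply Nat.floor_le_floor
      gcongr
      exact this.2.le
    · have key : ∀ x ∈ F, ∀ z ∈ F, ⌊(x - s) / δ⌋₊ = ⌊(z - s) / δ⌋₊ → ¬ x < z := by
        intro x hx z hz h hlt
        have h1 := hsep x hx z hz hlt
        have h2 : (⌊(x - s) / δ⌋₊ : ℝ) ≤ (x - s) / δ :=
          Nat.floor_le (div_nonneg (by linarith [(hF x hx).1]) hδ.le)
        have h3 := Nat.lt_floor_add_one ((z - s) / δ)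
        rw [← h] at h3
        have h4 : (z - s) / δ - (x - s) / δ < 1 := by linarith
        rw [← sub_div, div_lt_one hδ] at h4
        linarith
      intro x hx z hz h
      exact le_antisymm (not_lt.1 (key z hz x hx h.symm)) (not_lt.1 (key x hx z hz h))
  rw [Finset.card_range] at hcard
  have h1 : (F.card : ℝ) ≤ (⌊(t - s) / δ⌋₊ : ℝ) + 1 := by exact_mod_cast hcard
  have := Nat.floor_le (div_nonneg (sub_nonneg.2 hst) hδ.le)
  linarith

/-- A set meeting each half-open interval of length `δ` in `[s,t)` has many elements. -/
lemma dense_card (F : Finset ℝ) (s t δ : ℝ) (hδ : 0 < δ) (hst : s ≤ t)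
    (hF : ∀ u, s ≤ u → u + δ ≤ t → ∃ x ∈ F, x ∈ Set.Ico u (u + δ)) :
    (t - s) / δ - 1 ≤ (F.card : ℝ) := by
  set k := ⌊(t - s) / δ⌋₊ with hk
  have hkle : (k : ℝ) ≤ (t - s) / δ := Nat.floor_le (div_nonneg (sub_nonneg.2 hst) hδ.le)
  have hex : ∀ i : ℕ, i < k → ∃ x ∈ F, x ∈ Set.Ico (s + i * δ) (s + i * δ + δ) := by
    intro i hi
    apply hF
    · have : (0:ℝ) ≤ i * δ := by positivity
      linarith
    · have h1 : (i : ℝ) + 1 ≤ k := by exact_mod_cast hi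
      have h2 : ((i : ℝ) + 1) * δ ≤ t - s := by
        rw [← le_div_iff₀ hδ]; linarith
      linarith
  choose! g hg using hex
  have hcard : (Finset.range k).card ≤ F.card := by
    apply Finset.card_le_card_of_injOn g
    · intro i hi
      exact (hg i (by simpa using hi)).1
    · have key : ∀ i < k, ∀ j < k, g i = g j → ¬ i < j := by
        intro i hi j hj h hlt
        have h1 := (hg i hi).2.2
        have h2 := (hg j hj).2.1
        have h3 : (i : ℝ) + 1 ≤ j := by exact_mod_cast hlt
        have h4 : ((i : ℝ) + 1) * δ ≤ j * δ := by gcongr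
        rw [h] at h1
        linarith
      intro i hi j hj h
      simp only [Finset.coe_range, Set.mem_Iio] at hi hj
      exact le_antisymm (not_lt.1 (key j hj i hi h.symm)) (not_lt.1 (key i hi j hj h))
  rw [Finset.card_range] at hcard
  have h1 : (k : ℝ) ≤ F.card := by exact_mod_cast hcard
  have h2 := Nat.lt_floor_add_one ((t - s) / δ)
  linarith

/-- Finiteness of the real zero set in a bounded interval. -/
lemma zeros_finite (f f' P : ℝ → ℝ) (hf : ∀ x, HasDerivAt f (f' x) x)
    (hf' : ∀ x, HasDerivAt f' (-(P x) * f x) x) (hPc : Continuous P)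
    (hne : ∀ s t, s < t → ∃ x ∈ Set.Ioo s t, f x ≠ 0) (a b : ℝ) (hab : a ≤ b) :
    {x | x ∈ Set.Ico a b ∧ f x = 0}.Finite := by
  obtain ⟨C, hC⟩ := (isCompact_Icc (a := a) (b := b)).exists_bound_of_continuousOn
    hPc.continuousOn
  have hC0 : 0 ≤ C := (norm_nonneg _).trans (hC a (Set.left_mem_Icc.2 hab))
  set M := C + 1 with hMdef
  have hM : 0 < M := by linarith
  have hδ : 0 < Real.pi / M := div_pos Real.pi_pos hM
  by_contra hinf
  obtain ⟨F, hFsub, hFc⟩ := Set.Infinite.exists_subset_card_eq hinf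
    (⌈(b - a) / (Real.pi / M) + 1⌉₊ + 1)
  have := separated_card F a b (Real.pi / M) hδ hab (fun x hx => (hFsub hx).1) ?_
  · rw [hFc] at this
    have h2 := Nat.le_ceil ((b - a) / (Real.pi / M) + 1)
    push_cast at this
    linarith
  · intro x hx z hz hxz
    have h1 := hFsub hx
    have h2 := hFsub hz
    refine sturm_gap f f' P hf hf' hne M x z hM hxz ?_ h1.2 h2.2
    intro u hu
    have h3 := hC u ⟨h1.1.1.trans hu.1.le, hu.2.le.trans h2.1.2.le⟩
    have h4 := le_abs_self (P u)
    rw [Real.norm_eq_abs] at h3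
    nlinarith

/-- The estimate on one cell. -/
lemma cell_estimate (p ψ : ℝ → ℝ) (hpc : Continuous p) (hψ : Continuous ψ)
    (s t ε B : ℝ) (hst : s < t) (hε : 0 < ε) (hε1 : ε ≤ 1)
    (hBψ : |ψ s| ≤ B) (hBw : Real.sqrt (p s) ≤ B)
    (o1 : ∀ x ∈ Set.Icc s t, |ψ x - ψ s| ≤ ε)
    (o2 : ∀ x ∈ Set.Icc s t, |Real.sqrt (p x) - Real.sqrt (p s)| ≤ ε)
    (o3 : ∀ x ∈ Set.Icc s t, |ψ x * Real.sqrt (p x) - ψ s * Real.sqrt (p s)| ≤ ε)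
    (l : ℝ) (hl : 0 < l) (f f' : ℝ → ℝ) (hf : ∀ x, HasDerivAt f (f' x) x)
    (hf' : ∀ x, HasDerivAt f' (-(l ^ 2 * p x) * f x) x)
    (hne : ∀ s t, s < t → ∃ x ∈ Set.Ioo s t, f x ≠ 0)
    (F : Finset ℝ) (hF : ∀ x, x ∈ F ↔ x ∈ Set.Ico s t ∧ f x = 0) :
    |(1 / l) * ∑ x ∈ F, ψ x - (1 / Real.pi) * ∫ x in s..t, ψ x * Real.sqrt (p x)|
      ≤ (t - s) * (ε * (3 * B + 3)) + (B + 1) / l := by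
  have hπ := Real.pi_pos
  set w : ℝ → ℝ := fun x => Real.sqrt (p x) with hw
  have hB0 : 0 ≤ B := (abs_nonneg _).trans hBψ
  have hts : 0 < t - s := sub_pos.2 hst
  have hws : 0 ≤ w s := Real.sqrt_nonneg _
  have hpw : ∀ x, p x ≤ w x ^ 2 := fun x => by
    rcases le_total 0 (p x) with h | h
    · exact (Real.sq_sqrt h).ge
    · exact h.trans (sq_nonneg _)
  -- upper count
  have hup : (F.card : ℝ) / l ≤ (t - s) * (w s + 2 * ε) / Real.pi + 1 / l := by
    set M := l * (w s + 2 * ε) with hM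
    have hM0 : 0 < M := by positivity
    have h := separated_card F s t (Real.pi / M) (by positivity) hst.le
      (fun x hx => ((hF x).1 hx).1) ?_
    · rw [div_le_iff₀ hl]
      refine h.trans (le_of_eq ?_)
      rw [hM]
      field_simp
    · intro x hx z hz hxz
      have h1 := (hF x).1 hx
      have h2 := (hF z).1 hz
      refine sturm_gap f f' (fun x => l ^ 2 * p x) hf hf' hne M x z hM0 hxz ?_ h1.2 h2.2
      intro u hu
      have hou := o2 u ⟨h1.1.1.trans hu.1.le, hu.2.le.trans h2.1.2.le⟩
      have h3 : w u < w s + 2 * ε := by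
        have := (abs_le.1 hou).2
        simp only [hw]; linarith
      have h4 : w u ^ 2 < (w s + 2 * ε) ^ 2 := by
        have : 0 ≤ w u := Real.sqrt_nonneg _
        gcongr
      have h5 := (hpw u).trans_lt h4
      show l ^ 2 * p u < M ^ 2
      rw [hM, mul_pow]
      gcongr
  -- lower count
  have hlo : (t - s) * (w s - 2 * ε) / Real.pi - 1 / l ≤ (F.card : ℝ) / l := by
    rcases le_or_gt (w s - 2 * ε) 0 with h | h
    · have h1 : (t - s) * (w s - 2 * ε) / Real.pi ≤ 0 :=
        div_nonpos_of_nonpos_of_nonneg (mul_nonpos_of_nonneg_of_nonpos hts.le h) hπ.le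
      have h2 : 0 ≤ 1 / l := by positivity
      have h3 : 0 ≤ (F.card : ℝ) / l := by positivity
      linarith
    · set m := l * (w s - 2 * ε) with hm
      have hm0 : 0 < m := mul_pos hl h
      have hwpos := h
      have h := dense_card F s t (Real.pi / m) (by positivity) hst.le ?_
      · rw [le_div_iff₀ hl]
        refine le_trans (le_of_eq ?_) h
        have := hwpos.ne'
        rw [hm]
        field_simp
      · intro u hu hut
        have hmp : ∀ v ∈ Set.Ico u (u + Real.pi / m), m ^ 2 ≤ l ^ 2 * p v := by
          intro v hv
          have hov := o2 v ⟨hu.trans hv.1, hv.2.le.trans hut⟩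
          have h3 : w s - 2 * ε ≤ w v := by
            have := (abs_le.1 hov).1
            simp only [hw]; linarith
          have hwv : 0 < w v := hwpos.trans_le h3
          have hpv : 0 < p v := Real.sqrt_pos.1 hwv
          have h4 : p v = w v ^ 2 := (Real.sq_sqrt hpv.le).symm
          rw [hm, mul_pow, h4]
          gcongr
        obtain ⟨x, hx, hx0⟩ := sturm_exists_zero f f' (fun x => l ^ 2 * p x) hf hf' m u hm0 hmp
        exact ⟨x, (hF x).2 ⟨⟨hu.trans hx.1, hx.2.trans_le hut⟩, hx0⟩, hx⟩
  -- three differences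
  have hd2 : |(F.card : ℝ) / l - (t - s) * w s / Real.pi| ≤ (t - s) * (2 * ε) + 1 / l := by
    have hk : (t - s) * (2 * ε) / Real.pi ≤ (t - s) * (2 * ε) :=
      div_le_self (by positivity) (by linarith [Real.pi_gt_three])
    have e1 : (t - s) * (w s + 2 * ε) / Real.pi
        = (t - s) * w s / Real.pi + (t - s) * (2 * ε) / Real.pi := by ring
    have e2 : (t - s) * (w s - 2 * ε) / Real.pi
        = (t - s) * w s / Real.pi - (t - s) * (2 * ε) / Real.pi := by ring
    rw [abs_le]
    constructor <;> linarith
  have hd1 : |(1 / l) * ∑ x ∈ F, ψ x - ψ s * ((F.card : ℝ) / l)| ≤ ε * ((F.card : ℝ) / l) := by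
    have e : (1 / l) * ∑ x ∈ F, ψ x - ψ s * ((F.card : ℝ) / l)
        = (1 / l) * ∑ x ∈ F, (ψ x - ψ s) := by
      rw [Finset.sum_sub_distrib, Finset.sum_const, nsmul_eq_mul]; ring
    rw [e, abs_mul, abs_of_pos (by positivity : 0 < 1 / l)]
    have : |∑ x ∈ F, (ψ x - ψ s)| ≤ (F.card : ℝ) * ε := by
      refine (Finset.abs_sum_le_sum_abs _ _).trans ?_
      refine (Finset.sum_le_card_nsmul F _ ε ?_).trans (by rw [nsmul_eq_mul])
      intro x hx
      have := ((hF x).1 hx).1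
      exact o1 x ⟨this.1, this.2.le⟩
    calc 1 / l * |∑ x ∈ F, (ψ x - ψ s)| ≤ 1 / l * ((F.card : ℝ) * ε) := by gcongr
      _ = _ := by ring
  have hcardle : (F.card : ℝ) / l ≤ (t - s) * (B + 2) + 1 / l := by
    refine hup.trans ?_
    have h1 : (t - s) * (w s + 2 * ε) / Real.pi ≤ (t - s) * (w s + 2 * ε) :=
      div_le_self (by positivity) (by linarith [Real.pi_gt_three])
    have h2 : (t - s) * (w s + 2 * ε) ≤ (t - s) * (B + 2) := by
      gcongr; linarith
    linarith
  have hwc : Continuous w := Real.continuous_sqrt.comp hpc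
  have hd3 : |(t - s) * (ψ s * w s) - ∫ x in s..t, ψ x * w x| ≤ ε * (t - s) := by
    have hcc : Continuous fun x => ψ x * w x := hψ.mul hwc
    have hi : ∫ x in s..t, (ψ s * w s) = (t - s) * (ψ s * w s) := by
      rw [intervalIntegral.integral_const, smul_eq_mul]
    rw [← hi, ← intervalIntegral.integral_sub (continuous_const.intervalIntegrable _ _)
      (hcc.intervalIntegrable _ _)]
    have := intervalIntegral.norm_integral_le_of_norm_le_const (a := s) (b := t) (C := ε)
      (f := fun x => ψ s * w s - ψ x * w x) ?_
    · rw [abs_of_pos hts] at this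
      simpa using this
    · intro x hx
      rw [Set.uIoc_of_le hst.le] at hx
      rw [Real.norm_eq_abs, abs_sub_comm]
      exact o3 x ⟨hx.1.le, hx.2⟩
  have hd3' : |ψ s * ((t - s) * w s / Real.pi)
      - (1 / Real.pi) * ∫ x in s..t, ψ x * w x| ≤ ε * (t - s) := by
    have e : ψ s * ((t - s) * w s / Real.pi) - (1 / Real.pi) * ∫ x in s..t, ψ x * w x
        = (1 / Real.pi) * ((t - s) * (ψ s * w s) - ∫ x in s..t, ψ x * w x) := by ring
    rw [e, abs_mul, abs_of_pos (by positivity : 0 < 1 / Real.pi)]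
    have h1 : 1 / Real.pi ≤ 1 := by
      rw [div_le_one hπ]; linarith [Real.pi_gt_three]
    calc 1 / Real.pi * |(t - s) * (ψ s * w s) - ∫ x in s..t, ψ x * w x|
        ≤ 1 * |(t - s) * (ψ s * w s) - ∫ x in s..t, ψ x * w x| := by gcongr
      _ ≤ _ := by rw [one_mul]; exact hd3
  have hd2' : |ψ s * ((F.card : ℝ) / l) - ψ s * ((t - s) * w s / Real.pi)|
      ≤ B * ((t - s) * (2 * ε) + 1 / l) := by
    rw [← mul_sub, abs_mul]
    gcongr
  have htri : |(1 / l) * ∑ x ∈ F, ψ x - (1 / Real.pi) * ∫ x in s..t, ψ x * w x|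
      ≤ ε * ((F.card : ℝ) / l) + B * ((t - s) * (2 * ε) + 1 / l) + ε * (t - s) := by
    have h1 := abs_sub_le ((1 / l) * ∑ x ∈ F, ψ x) (ψ s * ((F.card : ℝ) / l))
      ((1 / Real.pi) * ∫ x in s..t, ψ x * w x)
    have h2 := abs_sub_le (ψ s * ((F.card : ℝ) / l)) (ψ s * ((t - s) * w s / Real.pi))
      ((1 / Real.pi) * ∫ x in s..t, ψ x * w x)
    linarith
  refine htri.trans ?_
  have h5 : ε * ((F.card : ℝ) / l) ≤ ε * ((t - s) * (B + 2)) + 1 / l := by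
    calc ε * ((F.card : ℝ) / l) ≤ ε * ((t - s) * (B + 2) + 1 / l) := by gcongr
      _ = ε * ((t - s) * (B + 2)) + ε * (1 / l) := by ring
      _ ≤ ε * ((t - s) * (B + 2)) + 1 * (1 / l) := by gcongr
      _ = _ := by ring
  have e : (t - s) * (ε * (3 * B + 3)) + (B + 1) / l
    = ε * ((t - s) * (B + 2)) + 1 / l + B * ((t - s) * (2 * ε) + 1 / l) + ε * (t - s) := by ring
  linarith

/-- Equidistribution of real zeros, uniformly in the solution. -/
lemma equidistribution (a b : ℝ) (hab : a < b) (p ψ : ℝ → ℝ) (hpc : Continuous p)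
    (hψ : Continuous ψ) (η : ℝ) (hη : 0 < η) :
    ∃ L : ℝ, ∀ l : ℝ, L ≤ l → 0 < l → ∀ f f' : ℝ → ℝ, (∀ x, HasDerivAt f (f' x) x) →
      (∀ x, HasDerivAt f' (-(l ^ 2 * p x) * f x) x) →
      (∀ s t, s < t → ∃ x ∈ Set.Ioo s t, f x ≠ 0) →
      ∀ F : Finset ℝ, (∀ x, x ∈ F ↔ x ∈ Set.Ico a b ∧ f x = 0) →
      |(1 / l) * ∑ x ∈ F, ψ x - (1 / Real.pi) * ∫ x in a..b, ψ x * Real.sqrt (p x)| < η := by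
  have hwc : Continuous fun x => Real.sqrt (p x) := Real.continuous_sqrt.comp hpc
  obtain ⟨B1, hB1⟩ := (isCompact_Icc (a := a) (b := b)).exists_bound_of_continuousOn
    hψ.continuousOn
  obtain ⟨B2, hB2⟩ := (isCompact_Icc (a := a) (b := b)).exists_bound_of_continuousOn
    hwc.continuousOn
  set B := max B1 B2 with hB
  have haI : a ∈ Set.Icc a b := Set.left_mem_Icc.2 hab.le
  have hB0 : 0 ≤ B := ((norm_nonneg _).trans (hB1 a haI)).trans (le_max_left _ _)
  have hba : 0 < b - a := sub_pos.2 hab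
  set ε := min 1 (η / (2 * ((b - a) * (3 * B + 3)))) with hεdef
  have hε : 0 < ε := lt_min one_pos (by positivity)
  have hε1 : ε ≤ 1 := min_le_left _ _
  have hεη : (b - a) * (ε * (3 * B + 3)) ≤ η / 2 := by
    have h : ε ≤ η / (2 * ((b - a) * (3 * B + 3))) := min_le_right _ _
    rw [le_div_iff₀ (by positivity)] at h
    linarith
  have huc : ∀ g : ℝ → ℝ, Continuous g → ∃ δ > 0, ∀ x ∈ Set.Icc a b, ∀ z ∈ Set.Icc a b,
      |x - z| < δ → |g x - g z| ≤ ε := by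
    intro g hg
    have := isCompact_Icc.uniformContinuousOn_of_continuous
      (hg.continuousOn (s := Set.Icc a b))
    rw [Metric.uniformContinuousOn_iff] at this
    obtain ⟨δ, hδ, h⟩ := this ε hε
    exact ⟨δ, hδ, fun x hx z hz hxz => (h x hx z hz hxz).le⟩
  obtain ⟨δ1, hδ1, H1⟩ := huc ψ hψ
  obtain ⟨δ2, hδ2, H2⟩ := huc _ hwc
  obtain ⟨δ3, hδ3, H3⟩ := huc _ (hψ.mul hwc)
  set δ := min δ1 (min δ2 δ3) with hδdef
  have hδ : 0 < δ := lt_min hδ1 (lt_min hδ2 hδ3)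
  obtain ⟨k, hk⟩ := exists_nat_gt ((b - a) / δ)
  have hk0 : (0 : ℝ) < k := lt_of_le_of_lt (by positivity) hk
  set h := (b - a) / k with hh
  have hh0 : 0 < h := by positivity
  have hhδ : h < δ := by
    rw [hh, div_lt_iff₀ hk0]
    rw [div_lt_iff₀ hδ] at hk
    linarith
  have hkh : (k : ℝ) * h = b - a := by rw [hh]; field_simp
  refine ⟨(2 * k * (B + 1)) / η + 1, ?_⟩
  intro l hL hl f f' hf hf' hne F hF
  -- induction on the number of cells
  have ind : ∀ j : ℕ, j ≤ k →
      |(1 / l) * ∑ x ∈ F.filter (fun x => x < a + j * h), ψ x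
        - (1 / Real.pi) * ∫ x in a..(a + j * h), ψ x * Real.sqrt (p x)|
      ≤ (j * h) * (ε * (3 * B + 3)) + j * ((B + 1) / l) := by
    intro j
    induction j with
    | zero =>
      intro _
      have : F.filter (fun x => x < a + ((0 : ℕ) : ℝ) * h) = ∅ := by
        apply Finset.filter_eq_empty_iff.2
        intro x hx
        have := ((hF x).1 hx).1.1
        simpa using this
      rw [this]
      simp
    | succ j ih =>
      intro hj
      have ihj := ih (by omega)
      have hj1 : (j : ℝ) + 1 ≤ k := by exact_mod_cast hj
      set s := a + j * h with hs
      set t := a + ((j + 1 : ℕ) : ℝ) * h with ht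
      have hts : t - s = h := by rw [ht, hs]; push_cast; ring
      have hst : s < t := by linarith
      have hsa : a ≤ s := by
        have : (0 : ℝ) ≤ j * h := by positivity
        linarith
      have htb : t ≤ b := by
        have : ((j : ℝ) + 1) * h ≤ k * h := by gcongr
        rw [ht]; push_cast; linarith
      have hsI : s ∈ Set.Icc a b := ⟨hsa, by linarith⟩
      have hxI : ∀ x ∈ Set.Icc s t, x ∈ Set.Icc a b := fun x hx =>
        ⟨hsa.trans hx.1, hx.2.trans htb⟩
      have hxd : ∀ x ∈ Set.Icc s t, |x - s| < δ := fun x hx => by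
        rw [abs_of_nonneg (by linarith [hx.1])]
        linarith [hx.2]
      have hcell := cell_estimate p ψ hpc hψ s t ε B hst hε hε1
        ((hB1 s hsI).trans (le_max_left _ _))
        ((le_abs_self _).trans ((hB2 s hsI).trans (le_max_right _ _)))
        (fun x hx => H1 x (hxI x hx) s hsI ((hxd x hx).trans_le (min_le_left _ _)))
        (fun x hx => H2 x (hxI x hx) s hsI ((hxd x hx).trans_le
          ((min_le_right _ _).trans (min_le_left _ _))))
        (fun x hx => H3 x (hxI x hx) s hsI ((hxd x hx).trans_le
          ((min_le_right _ _).trans (min_le_right _ _))))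
        l hl f f' hf hf' hne (F.filter fun x => s ≤ x ∧ x < t) (by
          intro x
          rw [Finset.mem_filter, hF]
          constructor
          · rintro ⟨⟨_, h0⟩, h1⟩
            exact ⟨h1, h0⟩
          · rintro ⟨h1, h0⟩
            exact ⟨⟨⟨hsa.trans h1.1, h1.2.trans_le htb⟩, h0⟩, h1⟩)
      have hsum : ∑ x ∈ F.filter (fun x => x < t), ψ x
          = ∑ x ∈ F.filter (fun x => x < s), ψ x
            + ∑ x ∈ F.filter (fun x => s ≤ x ∧ x < t), ψ x := by
        rw [← Finset.sum_union]
        · congr 1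
          ext x
          simp only [Finset.mem_filter, Finset.mem_union]
          constructor
          · rintro ⟨h1, h2⟩
            rcases lt_or_ge x s with h3 | h3
            · exact Or.inl ⟨h1, h3⟩
            · exact Or.inr ⟨h1, h3, h2⟩
          · rintro (⟨h1, h2⟩ | ⟨h1, _, h2⟩)
            · exact ⟨h1, h2.trans hst⟩
            · exact ⟨h1, h2⟩
        · rw [Finset.disjoint_left]
          intro x h1 h2
          exact absurd (Finset.mem_filter.1 h1).2 (not_lt.2 (Finset.mem_filter.1 h2).2.1)
      have hIntg : ∫ x in a..t, ψ x * Real.sqrt (p x)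
          = (∫ x in a..s, ψ x * Real.sqrt (p x)) + ∫ x in s..t, ψ x * Real.sqrt (p x) :=
        (intervalIntegral.integral_add_adjacent_intervals
          ((hψ.mul hwc).intervalIntegrable _ _) ((hψ.mul hwc).intervalIntegrable _ _)).symm
      rw [hsum, hIntg]
      have e : (1 / l) * (∑ x ∈ F.filter (fun x => x < s), ψ x
            + ∑ x ∈ F.filter (fun x => s ≤ x ∧ x < t), ψ x)
          - (1 / Real.pi) * ((∫ x in a..s, ψ x * Real.sqrt (p x))
            + ∫ x in s..t, ψ x * Real.sqrt (p x))
          = ((1 / l) * ∑ x ∈ F.filter (fun x => x < s), ψ x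
            - (1 / Real.pi) * ∫ x in a..s, ψ x * Real.sqrt (p x))
          + ((1 / l) * ∑ x ∈ F.filter (fun x => s ≤ x ∧ x < t), ψ x
            - (1 / Real.pi) * ∫ x in s..t, ψ x * Real.sqrt (p x)) := by ring
      rw [e]
      refine (abs_add_le _ _).trans ((add_le_add ihj hcell).trans (le_of_eq ?_))
      rw [hts]
      push_cast
      ring
  have hfin := ind k le_rfl
  have hakb : a + k * h = b := by linarith
  rw [hakb, hkh] at hfin
  have hFf : F.filter (fun x => x < b) = F := by
    apply Finset.filter_true_of_mem
    intro x hx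
    exact ((hF x).1 hx).1.2
  rw [hFf] at hfin
  refine hfin.trans_lt ?_
  have : (k : ℝ) * ((B + 1) / l) < η / 2 := by
    have h1 : 2 * k * (B + 1) / η < l := by linarith
    rw [div_lt_iff₀ hη] at h1
    rw [← mul_div_assoc, div_lt_iff₀ hl]
    linarith
  linarith

/-- An entire function vanishing on a small segment vanishes identically. -/
lemma entire_eq_zero_of_segment (g : ℂ → ℂ) (hg : Differentiable ℂ g) (c d : ℂ) (hd : d ≠ 0)
    (r : ℝ) (hr : 0 < r) (h : ∀ t ∈ Set.Ioo 0 r, g (c + (t : ℂ) * d) = 0) : ∀ z, g z = 0 := by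
  have han : AnalyticOnNhd ℂ g Set.univ := fun z _ => hg.analyticAt z
  have ht : Tendsto (fun t : ℝ => c + (t : ℂ) * d) (𝓝[>] 0) (𝓝[≠] c) := by
    apply tendsto_nhdsWithin_of_tendsto_nhds_of_eventually_within
    · have : Continuous fun t : ℝ => c + (t : ℂ) * d := by fun_prop
      have h2 := this.tendsto 0
      simp only [Complex.ofReal_zero, zero_mul, add_zero] at h2
      exact h2.mono_left nhdsWithin_le_nhds
    · filter_upwards [self_mem_nhdsWithin] with t ht
      have ht' : (t : ℂ) ≠ 0 := by exact_mod_cast (ne_of_gt ht)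
      simp [ht', hd]
  have hev : ∀ᶠ t : ℝ in 𝓝[>] 0, g (c + (t : ℂ) * d) = 0 := by
    filter_upwards [Ioo_mem_nhdsGT hr] with t ht using h t ht
  have hfr : ∃ᶠ z in 𝓝[≠] c, g z = 0 := ht.frequently hev.frequently
  intro z
  exact han.eqOn_zero_of_preconnected_of_frequently_eq_zero isPreconnected_univ
    (Set.mem_univ c) hfr (Set.mem_univ z)

/-- An `L²` solution is, up to a constant, symmetric under conjugation. -/
lemma eigen_symm (q : ℂ → ℂ) (Q : ℝ → ℝ) (hqQ : ∀ x : ℝ, q x = (Q x : ℂ)) (a : ℝ)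
    (hQ : ∀ x, a ≤ x → 0 ≤ Q x) (l : ℝ) (y : ℂ → ℂ) (hy : IsEigen q l y) :
    ∃ γ : ℂ, γ ≠ 0 ∧ ∀ z, (starRingEnd ℂ) (γ * y ((starRingEnd ℂ) z)) = γ * y z := by
  obtain ⟨hl, hdy, -, hode, hIntg⟩ := hy
  obtain ⟨β, hβ, hβa⟩ : ∃ β : ℂ, β ≠ 0 ∧ (β * y a).re = 0 := by
    by_cases h : y a = 0
    · exact ⟨1, one_ne_zero, by simp [h]⟩
    · exact ⟨Complex.I / y a, div_ne_zero Complex.I_ne_zero h, by rw [div_mul_cancel₀ _ h]; simp⟩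
  have hd1 : ∀ z, HasDerivAt y (deriv y z) z := fun z => (hdy z).hasDerivAt
  have hd2 : ∀ z, HasDerivAt (deriv y) ((l : ℂ) ^ 2 * q z * y z) z := fun z => by
    rw [← hode z]
    exact (hdy.analyticAt z).deriv.differentiableAt.hasDerivAt
  set w : ℝ → ℝ := fun x => (β * y x).re with hw
  set w' : ℝ → ℝ := fun x => (β * deriv y x).re with hw'
  have hw1 : ∀ x, HasDerivAt w (w' x) x := fun x => ((hd1 x).const_mul β).real_of_complex
  have hw2 : ∀ x, HasDerivAt w' (l ^ 2 * Q x * w x) x := fun x => by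
    refine (((hd2 x).const_mul β).real_of_complex).congr_deriv ?_
    have : β * ((l : ℂ) ^ 2 * q x * y x) = ((l ^ 2 * Q x : ℝ) : ℂ) * (β * y x) := by
      rw [hqQ]; push_cast; ring
    rw [this, Complex.re_ofReal_mul]
  have hwa : w a = 0 := hβa
  have hprod : ∀ x, HasDerivAt (fun x => w x * w' x) (w' x ^ 2 + l ^ 2 * Q x * w x ^ 2) x :=
    fun x => ((hw1 x).mul (hw2 x)).congr_deriv (by ring)
  have hmono1 : MonotoneOn (fun x => w x * w' x) (Set.Ici a) := by
    apply monotoneOn_of_deriv_nonneg (convex_Ici a)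
    · exact fun x _ => (hprod x).continuousAt.continuousWithinAt
    · exact fun x _ => (hprod x).differentiableAt.differentiableWithinAt
    · intro x hx
      rw [interior_Ici] at hx
      rw [(hprod x).deriv]
      have := hQ x (le_of_lt hx)
      positivity
  have hsq : ∀ x, HasDerivAt (fun x => w x ^ 2) (2 * (w x * w' x)) x := fun x =>
    ((hw1 x).pow 2).congr_deriv (by simp; ring)
  have hmono2 : MonotoneOn (fun x => w x ^ 2) (Set.Ici a) := by
    apply monotoneOn_of_deriv_nonneg (convex_Ici a)
    · exact fun x _ => (hsq x).continuousAt.continuousWithinAt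
    · exact fun x _ => (hsq x).differentiableAt.differentiableWithinAt
    · intro x hx
      rw [interior_Ici] at hx
      rw [(hsq x).deriv]
      have := hmono1 (Set.self_mem_Ici) (le_of_lt hx : a ≤ x) (le_of_lt hx)
      simp only [hwa, zero_mul] at this
      linarith
  have hw0 : ∀ x, a ≤ x → w x = 0 := by
    intro x hx
    by_contra hne
    have hpos : 0 < w x ^ 2 := by positivity
    have hcint : IntegrableOn (fun _ : ℝ => w x ^ 2) (Set.Ici x) := by
      refine Integrable.mono' ((hIntg.const_mul (‖β‖ ^ 2)).integrableOn (s := Set.Ici x))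
        aestronglyMeasurable_const ?_
      refine (ae_restrict_mem measurableSet_Ici).mono ?_
      intro u hu
      have h1 := hmono2 (show x ∈ Set.Ici a from hx) (show u ∈ Set.Ici a from hx.trans hu) hu
      have h2 : w u ^ 2 ≤ ‖β‖ ^ 2 * ‖y u‖ ^ 2 := by
        rw [← mul_pow, ← norm_mul, ← sq_abs (w u)]
        exact pow_le_pow_left₀ (abs_nonneg _) (Complex.abs_re_le_norm _) 2
      rw [Real.norm_eq_abs, abs_of_pos hpos]
      exact h1.trans h2
    rw [integrableOn_const_iff] at hcint
    rcases hcint with h | h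
    · exact hpos.ne' (enorm_eq_zero.1 h)
    · simp at h
  refine ⟨Complex.I * β, mul_ne_zero Complex.I_ne_zero hβ, ?_⟩
  set g : ℂ → ℂ := fun z => Complex.I * β * y z with hg
  have hgd : Differentiable ℂ g := hdy.const_mul _
  have hgc : Differentiable ℂ (fun z => (starRingEnd ℂ) (g ((starRingEnd ℂ) z))) := fun z => by
    have := (hgd ((starRingEnd ℂ) z)).conj_conj
    simpa [Function.comp_def] using this
  have hz := entire_eq_zero_of_segment (fun z => (starRingEnd ℂ) (g ((starRingEnd ℂ) z)) - g z)
    (hgc.sub hgd) (a : ℂ) 1 one_ne_zero 1 one_pos (by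
      intro t ht
      have e : (a : ℂ) + (t : ℂ) * 1 = ((a + t : ℝ) : ℂ) := by push_cast; ring
      rw [e]
      simp only [Complex.conj_ofReal]
      rw [sub_eq_zero, Complex.conj_eq_iff_im]
      have h0 := hw0 (a + t) (by linarith [ht.1])
      simp only [hg, hw] at h0 ⊢
      rw [mul_assoc, Complex.I_mul_im]
      exact h0)
  intro z
  exact sub_eq_zero.1 (hz z)

/-- Near the allowed intervals all zeros are real. -/
lemma zero_is_real (q : ℂ → ℂ) (l : ℝ) (hl : 0 < l) (y : ℂ → ℂ) (hdy : Differentiable ℂ y)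
    (hne : ∃ z, y z ≠ 0)
    (hode : ∀ z : ℂ, deriv (deriv y) z = (l : ℂ) ^ 2 * q z * y z)
    (x τ : ℝ) (hτ : 0 < τ) (h1 : y ((x : ℂ) + (τ : ℂ) * Complex.I) = 0)
    (h2 : y ((x : ℂ) + ((-τ : ℝ) : ℂ) * Complex.I) = 0)
    (hq : ∀ t ∈ Set.Icc (-τ) τ, (q ((x : ℂ) + (t : ℂ) * Complex.I)).re < 0) : False := by
  have hd1 : ∀ z, HasDerivAt y (deriv y z) z := fun z => (hdy z).hasDerivAt
  have hd2 : ∀ z, HasDerivAt (deriv y) ((l : ℂ) ^ 2 * q z * y z) z := fun z => by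
    rw [← hode z]
    exact (hdy.analyticAt z).deriv.differentiableAt.hasDerivAt
  set c : ℝ → ℂ := fun t => (x : ℂ) + (t : ℂ) * Complex.I with hc
  have hcd : ∀ t, HasDerivAt c Complex.I t := fun t => by
    exact (((Complex.ofRealCLM.hasDerivAt (x := t)).mul_const Complex.I).const_add
      (x : ℂ)).congr_deriv (by simp)
  have hre : ∀ (f : ℝ → ℂ) (f' : ℂ) (t : ℝ), HasDerivAt f f' t →
      HasDerivAt (fun t => (f t).re) f'.re t := fun f f' t h =>
    Complex.reCLM.hasFDerivAt.comp_hasDerivAt t h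
  have him : ∀ (f : ℝ → ℂ) (f' : ℂ) (t : ℝ), HasDerivAt f f' t →
      HasDerivAt (fun t => (f t).im) f'.im t := fun f f' t h =>
    Complex.imCLM.hasFDerivAt.comp_hasDerivAt t h
  have hY : ∀ t, HasDerivAt (fun t => y (c t)) (deriv y (c t) * Complex.I) t := fun t =>
    (hd1 (c t)).comp t (hcd t)
  have hY' : ∀ t, HasDerivAt (fun t => deriv y (c t) * Complex.I)
      (-((l : ℂ) ^ 2 * q (c t) * y (c t))) t := fun t => by
    refine (((hd2 (c t)).comp t (hcd t)).mul_const Complex.I).congr_deriv ?_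
    rw [mul_assoc, Complex.I_mul_I]; ring
  set G : ℝ → ℝ := fun t => (y (c t)).re * (deriv y (c t) * Complex.I).re
    + (y (c t)).im * (deriv y (c t) * Complex.I).im with hG
  have hGd : ∀ t, HasDerivAt G ((deriv y (c t) * Complex.I).re ^ 2
      + (deriv y (c t) * Complex.I).im ^ 2
      + l ^ 2 * (-(q (c t)).re) * ((y (c t)).re ^ 2 + (y (c t)).im ^ 2)) t := fun t => by
    refine (((hre _ _ t (hY t)).mul (hre _ _ t (hY' t))).add
      ((him _ _ t (hY t)).mul (him _ _ t (hY' t)))).congr_deriv ?_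
    have e : (l : ℂ) ^ 2 * q (c t) * y (c t) = ((l ^ 2 : ℝ) : ℂ) * (q (c t) * y (c t)) := by
      push_cast; ring
    rw [e]
    simp only [Complex.neg_re, Complex.neg_im, Complex.re_ofReal_mul, Complex.im_ofReal_mul,
      Complex.mul_re (q (c t)), Complex.mul_im (q (c t))]
    ring
  have hmono : MonotoneOn G (Set.Icc (-τ) τ) := by
    apply monotoneOn_of_deriv_nonneg (convex_Icc _ _)
    · exact fun t _ => (hGd t).continuousAt.continuousWithinAt
    · exact fun t _ => (hGd t).differentiableAt.differentiableWithinAt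
    · intro t ht
      rw [interior_Icc] at ht
      rw [(hGd t).deriv]
      have := hq t (Set.Ioo_subset_Icc_self ht)
      have h3 : 0 ≤ -(q (c t)).re := by simp only [hc]; linarith
      positivity
  have hττ : -τ ≤ τ := by linarith
  have hG1 : G τ = 0 := by simp only [hG, hc, h1]; simp
  have hG2 : G (-τ) = 0 := by simp only [hG, hc, h2]; simp
  have hG0 : ∀ t ∈ Set.Icc (-τ) τ, G t = 0 := by
    intro t ht
    apply le_antisymm
    · rw [← hG1]; exact hmono ht (Set.right_mem_Icc.2 hττ) ht.2
    · rw [← hG2]; exact hmono (Set.left_mem_Icc.2 hττ) ht ht.1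
  have hyc : ∀ t ∈ Set.Ioo 0 τ, y ((x : ℂ) + (t : ℂ) * Complex.I) = 0 := by
    intro t ht
    have htI : -τ < t := by linarith [ht.1]
    have hev : G =ᶠ[𝓝 t] fun _ => 0 := by
      filter_upwards [Ioo_mem_nhds htI ht.2] with u hu
      exact hG0 u (Set.Ioo_subset_Icc_self hu)
    have h0 := (hGd t).unique ((hasDerivAt_const t (0 : ℝ)).congr_of_eventuallyEq hev)
    have hqt := hq t ⟨htI.le, ht.2.le⟩
    have hk : 0 < l ^ 2 * (-(q (c t)).re) :=
      mul_pos (by positivity) (by simp only [hc]; linarith)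
    have hs : (y (c t)).re ^ 2 + (y (c t)).im ^ 2 = 0 := by
      by_contra hne0
      have hpos : 0 < (y (c t)).re ^ 2 + (y (c t)).im ^ 2 :=
        lt_of_le_of_ne (by positivity) (Ne.symm hne0)
      have := mul_pos hk hpos
      nlinarith [sq_nonneg (deriv y (c t) * Complex.I).re,
        sq_nonneg (deriv y (c t) * Complex.I).im]
    apply Complex.ext
    · have : (y (c t)).re ^ 2 = 0 := by nlinarith [sq_nonneg (y (c t)).re, sq_nonneg (y (c t)).im]
      simpa using this
    · have : (y (c t)).im ^ 2 = 0 := by nlinarith [sq_nonneg (y (c t)).re, sq_nonneg (y (c t)).im]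
      simpa using this
  obtain ⟨z, hz⟩ := hne
  exact hz (entire_eq_zero_of_segment y hdy x Complex.I Complex.I_ne_zero τ hτ hyc z)

/-- For a double-well quartic potential, the classically allowed intervals
`(a₀,a₁) ∪ (a₂,a₃)` are zero lines for the full eigenvalue sequence: near any
compact subset of them the zero-counting measures converge to `(1/π)√|q| dx`. -/
theorem double_well_allowed_intervals_are_zero_lines
    (a₀ a₁ a₂ a₃ : ℝ) (h01 : a₀ < a₁) (h12 : a₁ < a₂) (h23 : a₂ < a₃)
    (q : ℂ → ℂ)
    (hq : ∀ z : ℂ, q z = (z - (a₀ : ℂ)) * (z - (a₁ : ℂ)) * (z - (a₂ : ℂ)) * (z - (a₃ : ℂ)))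
    (lam : ℕ → ℝ) (y : ℕ → ℂ → ℂ)
    (hlam : Tendsto lam atTop atTop)
    (heig : ∀ n, IsEigen q (lam n) (y n))
    (K : Set ℝ) (hK : IsCompact K)
    (hKsub : K ⊆ Set.Ioo a₀ a₁ ∪ Set.Ioo a₂ a₃) :
    ∃ V : Set ℂ, IsOpen V ∧ (∀ x ∈ K, (x : ℂ) ∈ V) ∧
      ∀ φ : ℂ → ℝ, Continuous φ → HasCompactSupport φ → tsupport φ ⊆ V →
        Tendsto (fun n => (1 / lam n) * zeroSum (y n) φ) atTop
          (nhds ((1 / Real.pi) *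
            ((∫ x in a₀..a₁, φ (x : ℂ) *
                Real.sqrt |(x - a₀) * (x - a₁) * (x - a₂) * (x - a₃)|)
            + ∫ x in a₂..a₃, φ (x : ℂ) *
                Real.sqrt |(x - a₀) * (x - a₁) * (x - a₂) * (x - a₃)|))) := by
  set Q : ℝ → ℝ := fun x => (x - a₀) * (x - a₁) * (x - a₂) * (x - a₃) with hQdef
  have hqQ : ∀ x : ℝ, q x = (Q x : ℂ) := fun x => by rw [hq, hQdef]; push_cast; ring
  have hQc : Continuous Q := by rw [hQdef]; fun_prop
  have h03 : a₀ < a₃ := by linarith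
  set L := a₃ - a₀ with hL
  -- real part of `q` near the real axis
  have hqre : ∀ x t : ℝ, a₀ < x → x < a₃ →
      (q ((x : ℂ) + (t : ℂ) * Complex.I)).re ≤ Q x + 6 * L ^ 2 * t ^ 2 + t ^ 4 := by
    intro x t hx0 hx3
    have e : (q ((x : ℂ) + (t : ℂ) * Complex.I)).re = Q x - t ^ 2 *
        ((x - a₀) * (x - a₁) + (x - a₀) * (x - a₂) + (x - a₀) * (x - a₃)
          + (x - a₁) * (x - a₂) + (x - a₁) * (x - a₃) + (x - a₂) * (x - a₃)) + t ^ 4 := by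
      rw [hq]
      simp [Complex.mul_re, Complex.mul_im, hQdef]
      ring
    have hb : ∀ u v : ℝ, |u| ≤ L → |v| ≤ L → -(u * v) ≤ L ^ 2 := by
      intro u v hu hv
      have h1 : -(u * v) ≤ |u| * |v| := by rw [← abs_mul]; exact neg_le_abs _
      have h2 : |u| * |v| ≤ L * L := mul_le_mul hu hv (abs_nonneg _) (by linarith)
      nlinarith
    have b0 : |x - a₀| ≤ L := abs_le.2 ⟨by linarith, by linarith⟩
    have b1 : |x - a₁| ≤ L := abs_le.2 ⟨by linarith, by linarith⟩
    have b2 : |x - a₂| ≤ L := abs_le.2 ⟨by linarith, by linarith⟩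
    have b3 : |x - a₃| ≤ L := abs_le.2 ⟨by linarith, by linarith⟩
    have hs : -((x - a₀) * (x - a₁) + (x - a₀) * (x - a₂) + (x - a₀) * (x - a₃)
          + (x - a₁) * (x - a₂) + (x - a₁) * (x - a₃) + (x - a₂) * (x - a₃)) ≤ 6 * L ^ 2 := by
      linarith [hb _ _ b0 b1, hb _ _ b0 b2, hb _ _ b0 b3, hb _ _ b1 b2, hb _ _ b1 b3,
        hb _ _ b2 b3]
    have := mul_le_mul_of_nonneg_left hs (sq_nonneg t)
    rw [e]
    linarith
  -- signs of `Q`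
  have hQ1 : ∀ x, a₀ ≤ x → x ≤ a₁ → Q x ≤ 0 := fun x h0 h1 => by
    have e1 : 0 ≤ (x - a₀) * (a₁ - x) := mul_nonneg (by linarith) (by linarith)
    have e2 : 0 ≤ (a₂ - x) * (a₃ - x) := mul_nonneg (by linarith) (by linarith)
    have := mul_nonneg e1 e2
    simp only [hQdef]; linarith
  have hQ2 : ∀ x, a₁ ≤ x → x ≤ a₂ → 0 ≤ Q x := fun x h0 h1 => by
    have e1 : 0 ≤ (x - a₀) * (x - a₁) := mul_nonneg (by linarith) (by linarith)
    have e2 : 0 ≤ (a₂ - x) * (a₃ - x) := mul_nonneg (by linarith) (by linarith)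
    have := mul_nonneg e1 e2
    simp only [hQdef]; linarith
  have hQ3 : ∀ x, a₂ ≤ x → x ≤ a₃ → Q x ≤ 0 := fun x h0 h1 => by
    have e1 : 0 ≤ (x - a₀) * (x - a₁) := mul_nonneg (by linarith) (by linarith)
    have e2 : 0 ≤ (x - a₂) * (a₃ - x) := mul_nonneg (by linarith) (by linarith)
    have := mul_nonneg e1 e2
    simp only [hQdef]; linarith
  have hQ4 : ∀ x, a₃ ≤ x → 0 ≤ Q x := fun x h0 => by
    have e1 : 0 ≤ (x - a₀) * (x - a₁) := mul_nonneg (by linarith) (by linarith)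
    have e2 : 0 ≤ (x - a₂) * (x - a₃) := mul_nonneg (by linarith) (by linarith)
    have := mul_nonneg e1 e2
    simp only [hQdef]; linarith
  have hQne : ∀ x, x ∈ Set.Ioo a₀ a₁ ∪ Set.Ioo a₂ a₃ → Q x < 0 := by
    rintro x (h | h)
    · have e1 : 0 < (x - a₀) * (a₁ - x) := mul_pos (by linarith [h.1]) (by linarith [h.2])
      have e2 : 0 < (a₂ - x) * (a₃ - x) := mul_pos (by linarith [h.2]) (by linarith [h.2])
      have := mul_pos e1 e2
      simp only [hQdef]; linarith
    · have e1 : 0 < (x - a₀) * (x - a₁) := mul_pos (by linarith [h.1]) (by linarith [h.1])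
      have e2 : 0 < (x - a₂) * (a₃ - x) := mul_pos (by linarith [h.1]) (by linarith [h.2])
      have := mul_pos e1 e2
      simp only [hQdef]; linarith
  refine ⟨{z | a₀ < z.re ∧ z.re < a₃ ∧ Q z.re + 6 * L ^ 2 * z.im ^ 2 + z.im ^ 4 < 0}, ?_, ?_, ?_⟩
  · have h1 : Continuous fun z : ℂ => Q z.re := hQc.comp Complex.continuous_re
    have h2 := Complex.continuous_im
    have h3 : Continuous fun z : ℂ => Q z.re + 6 * L ^ 2 * z.im ^ 2 + z.im ^ 4 := by fun_prop
    have o1 : IsOpen {z : ℂ | a₀ < z.re} := isOpen_lt continuous_const Complex.continuous_re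
    have o2 : IsOpen {z : ℂ | z.re < a₃} := isOpen_lt Complex.continuous_re continuous_const
    have o3 : IsOpen {z : ℂ | Q z.re + 6 * L ^ 2 * z.im ^ 2 + z.im ^ 4 < 0} :=
      isOpen_lt h3 continuous_const
    exact o1.inter (o2.inter o3)
  · intro x hx
    have hxs := hKsub hx
    have hneg := hQne x hxs
    refine ⟨?_, ?_, ?_⟩
    · rcases hxs with h | h
      · simpa using h.1
      · simpa using (by linarith [h.1] : a₀ < x)
    · rcases hxs with h | h
      · simpa using (by linarith [h.2] : x < a₃)
      · simpa using h.2
    · simpa using hneg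
  intro φ hφc hφs hφV
  set V : Set ℂ := {z | a₀ < z.re ∧ z.re < a₃ ∧ Q z.re + 6 * L ^ 2 * z.im ^ 2 + z.im ^ 4 < 0}
    with hV
  set p : ℝ → ℝ := fun x => - Q x with hp
  have hpc : Continuous p := hQc.neg
  set ψ : ℝ → ℝ := fun x => φ (x : ℂ) with hψ
  have hψc : Continuous ψ := hφc.comp Complex.continuous_ofReal
  -- the limit as one integral
  have hII : ∀ u v : ℝ, IntervalIntegrable (fun x => ψ x * Real.sqrt (p x)) volume u v :=
    fun u v => (hψc.mul (Real.continuous_sqrt.comp hpc)).intervalIntegrable u v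
  have hlim : (∫ x in a₀..a₃, ψ x * Real.sqrt (p x))
      = (∫ x in a₀..a₁, φ (x : ℂ) * Real.sqrt |Q x|)
        + ∫ x in a₂..a₃, φ (x : ℂ) * Real.sqrt |Q x| := by
    rw [← intervalIntegral.integral_add_adjacent_intervals (hII a₀ a₁) (hII a₁ a₃),
      ← intervalIntegral.integral_add_adjacent_intervals (hII a₁ a₂) (hII a₂ a₃)]
    have i2 : ∫ x in a₁..a₂, ψ x * Real.sqrt (p x) = 0 := by
      rw [intervalIntegral.integral_congr (g := fun _ => (0 : ℝ))]
      · simp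
      · intro x hx
        rw [Set.uIcc_of_le h12.le] at hx
        have : p x ≤ 0 := by have := hQ2 x hx.1 hx.2; simp only [hp]; linarith
        simp [Real.sqrt_eq_zero_of_nonpos this]
    have i1 : ∫ x in a₀..a₁, ψ x * Real.sqrt (p x)
        = ∫ x in a₀..a₁, φ (x : ℂ) * Real.sqrt |Q x| := by
      apply intervalIntegral.integral_congr
      intro x hx
      rw [Set.uIcc_of_le h01.le] at hx
      simp only [hp, hψ, abs_of_nonpos (hQ1 x hx.1 hx.2)]
    have i3 : ∫ x in a₂..a₃, ψ x * Real.sqrt (p x)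
        = ∫ x in a₂..a₃, φ (x : ℂ) * Real.sqrt |Q x| := by
      apply intervalIntegral.integral_congr
      intro x hx
      rw [Set.uIcc_of_le h23.le] at hx
      simp only [hp, hψ, abs_of_nonpos (hQ3 x hx.1 hx.2)]
    rw [i1, i2, i3, zero_add]
  show Tendsto _ _ (𝓝 ((1 / Real.pi) * ((∫ x in a₀..a₁, φ (x : ℂ) * Real.sqrt |Q x|)
        + ∫ x in a₂..a₃, φ (x : ℂ) * Real.sqrt |Q x|)))
  rw [← hlim, Metric.tendsto_atTop]
  intro η hη
  obtain ⟨L₀, hL₀⟩ := equidistribution a₀ a₃ h03 p ψ hpc hψc η hη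
  obtain ⟨N, hN⟩ := eventually_atTop.1 (hlam.eventually_ge_atTop L₀)
  refine ⟨N, fun n hn => ?_⟩
  obtain ⟨γ, hγ, hsym⟩ := eigen_symm q Q hqQ a₃ hQ4 (lam n) (y n) (heig n)
  obtain ⟨hl, hdy, hnz, hode, -⟩ := heig n
  have hd1 : ∀ z, HasDerivAt (y n) (deriv (y n) z) z := fun z => (hdy z).hasDerivAt
  have hd2 : ∀ z, HasDerivAt (deriv (y n)) ((lam n : ℂ) ^ 2 * q z * y n z) z := fun z => by
    rw [← hode z]
    exact (hdy.analyticAt z).deriv.differentiableAt.hasDerivAt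
  set f : ℝ → ℝ := fun x => (γ * y n x).re with hf
  set f' : ℝ → ℝ := fun x => (γ * deriv (y n) x).re with hf'
  have hf1 : ∀ x, HasDerivAt f (f' x) x := fun x => ((hd1 x).const_mul γ).real_of_complex
  have hf2 : ∀ x, HasDerivAt f' (-(lam n ^ 2 * p x) * f x) x := fun x => by
    refine (((hd2 x).const_mul γ).real_of_complex).congr_deriv ?_
    have : γ * ((lam n : ℂ) ^ 2 * q x * y n x)
        = ((-(lam n ^ 2 * p x) : ℝ) : ℂ) * (γ * y n x) := by
      rw [hqQ]; simp only [hp]; push_cast; ring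
    rw [this, Complex.re_ofReal_mul]
  have hfy : ∀ x : ℝ, f x = 0 ↔ y n x = 0 := by
    intro x
    have h1 := hsym x
    rw [Complex.conj_ofReal, Complex.conj_eq_iff_im] at h1
    constructor
    · intro h
      have : γ * y n x = 0 := Complex.ext h h1
      exact (mul_eq_zero.1 this).resolve_left hγ
    · intro h
      simp [hf, h]
  have hfne : ∀ s t, s < t → ∃ x ∈ Set.Ioo s t, f x ≠ 0 := by
    intro s t hst
    by_contra hcon
    push Not at hcon
    obtain ⟨z, hz⟩ := hnz
    refine hz (entire_eq_zero_of_segment (y n) hdy s 1 one_ne_zero (t - s) (sub_pos.2 hst) ?_ z)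
    intro u hu
    have e : (s : ℂ) + (u : ℂ) * 1 = ((s + u : ℝ) : ℂ) := by push_cast; ring
    rw [e]
    exact (hfy _).1 (hcon (s + u) ⟨by linarith [hu.1], by linarith [hu.2]⟩)
  have hfin := zeros_finite f f' (fun x => lam n ^ 2 * p x) hf1 hf2 (continuous_const.mul hpc)
    hfne a₀ a₃ h03.le
  set F := hfin.toFinset with hFdef
  have hF : ∀ x, x ∈ F ↔ x ∈ Set.Ico a₀ a₃ ∧ f x = 0 := fun x => by
    rw [hFdef, Set.Finite.mem_toFinset]; rfl
  -- the zero sum is a sum over the real zeros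
  have hreal : ∀ z ∈ V, y n z = 0 → z.im = 0 := by
    intro z hz hz0
    by_contra him
    have hz0' : y n ((starRingEnd ℂ) z) = 0 := by
      have h1 := hsym z
      rw [hz0, mul_zero, map_eq_zero] at h1
      exact (mul_eq_zero.1 h1).resolve_left hγ
    have ez : z = (z.re : ℂ) + (z.im : ℂ) * Complex.I := (Complex.re_add_im z).symm
    have ez' : (starRingEnd ℂ) z = (z.re : ℂ) + ((-z.im : ℝ) : ℂ) * Complex.I := by
      apply Complex.ext <;> simp
    have hqn : ∀ t : ℝ, |t| ≤ |z.im| → (q ((z.re : ℂ) + (t : ℂ) * Complex.I)).re < 0 := by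
      intro t ht
      have h1 := hqre z.re t hz.1 hz.2.1
      have h2 : t ^ 2 ≤ z.im ^ 2 := sq_le_sq.2 ht
      have h3 : t ^ 4 ≤ z.im ^ 4 := by
        have := pow_le_pow_left₀ (sq_nonneg t) h2 2
        linarith [this, (by ring : (t ^ 2) ^ 2 = t ^ 4), (by ring : (z.im ^ 2) ^ 2 = z.im ^ 4)]
      have h4 : 6 * L ^ 2 * t ^ 2 ≤ 6 * L ^ 2 * z.im ^ 2 := by gcongr
      have h5 := hz.2.2
      linarith
    rcases lt_or_gt_of_ne him with h | h
    · refine zero_is_real q (lam n) hl (y n) hdy hnz hode z.re (-z.im) (by linarith) ?_ ?_ ?_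
      · rw [← ez']; exact hz0'
      · rw [neg_neg, ← ez]; exact hz0
      · intro t ht
        apply hqn
        rw [abs_of_neg h]
        exact abs_le.2 ht
    · refine zero_is_real q (lam n) hl (y n) hdy hnz hode z.re z.im h ?_ ?_ ?_
      · rw [← ez]; exact hz0
      · rw [← ez']; exact hz0'
      · intro t ht
        apply hqn
        rw [abs_of_pos h]
        exact abs_le.2 ht
  have hzs : zeroSum (y n) φ = ∑ x ∈ F, ψ x := by
    have e1 : zeroSum (y n) φ = ∑' z : ℂ, Set.indicator {z | y n z = 0} φ z :=
      tsum_subtype {z | y n z = 0} φ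
    rw [e1, tsum_eq_sum (s := F.map ⟨fun x : ℝ => (x : ℂ), Complex.ofReal_injective⟩)]
    · rw [Finset.sum_map]
      apply Finset.sum_congr rfl
      intro x hx
      have : (x : ℂ) ∈ {z | y n z = 0} := (hfy x).1 ((hF x).1 hx).2
      exact Set.indicator_of_mem this φ
    · intro z hz
      by_contra hne
      have hzm : z ∈ {z | y n z = 0} := Set.mem_of_indicator_ne_zero hne
      rw [Set.indicator_of_mem hzm] at hne
      have hzV : z ∈ V := hφV (subset_tsupport φ hne)
      have him := hreal z hzV hzm
      apply hz
      have ez : ((z.re : ℝ) : ℂ) = z := Complex.ext (by simp) (by simp [him])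
      rw [Finset.mem_map]
      refine ⟨z.re, (hF _).2 ⟨⟨hzV.1.le, hzV.2.1⟩, (hfy _).2 ?_⟩, ez⟩
      rw [ez]; exact hzm
  rw [Real.dist_eq, hzs]
  exact hL₀ (lam n) (hN n hn) hl f f' hf1 hf2 hfne F hF
end

section
/- (No zeros near the outer forbidden region for a double well.) Let a₀ < a₁ < a₂ < a₃ be real numbers and q(z) = (z−a₀)(z−a₁)(z−a₂)(z−a₃). Let (λ_n) be any sequence of positive reals with λ_n → ∞ such that each λ_n is an eigenvalue of q with eigenfunction y_n. Then for every compact set K ⊆ (−∞, a₀) ∪ (a₃, ∞) (a compact subset of the real line avoiding [a₀, a₃]) there exist an open neighborhood V of K in ℂ and an index N such that for all n ≥ N, y_n has no zeros in V. -/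
open MeasureTheory Filter Topology

/-- The real and imaginary parts of `g * conj f`. -/
theorem aux_derivs (f g Q : ℝ → ℂ) (hf : ∀ t, HasDerivAt f (g t) t)
    (hg : ∀ t, HasDerivAt g (Q t * f t) t) (t : ℝ) :
    HasDerivAt (fun t => (g t).re * (f t).re + (g t).im * (f t).im)
      ((g t).re ^ 2 + (g t).im ^ 2 + (Q t).re * ((f t).re ^ 2 + (f t).im ^ 2)) t ∧
    HasDerivAt (fun t => (g t).im * (f t).re - (g t).re * (f t).im)
      ((Q t).im * ((f t).re ^ 2 + (f t).im ^ 2)) t ∧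
    HasDerivAt (fun t => (f t).re ^ 2 + (f t).im ^ 2)
      (2 * ((g t).re * (f t).re + (g t).im * (f t).im)) t := by
  have hre : ∀ (F : ℝ → ℂ) (F' : ℂ), HasDerivAt F F' t →
      HasDerivAt (fun t => (F t).re) F'.re t := fun F F' h => by
    exact (Complex.reCLM.hasFDerivAt.comp_hasDerivAt t h)
  have him : ∀ (F : ℝ → ℂ) (F' : ℂ), HasDerivAt F F' t →
      HasDerivAt (fun t => (F t).im) F'.im t := fun F F' h => by
    exact (Complex.imCLM.hasFDerivAt.comp_hasDerivAt t h)
  have f1 := hre _ _ (hf t)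
  have f2 := him _ _ (hf t)
  have g1 := hre _ _ (hg t)
  have g2 := him _ _ (hg t)
  refine ⟨?_, ?_, ?_⟩
  · refine ((g1.mul f1).add (g2.mul f2)).congr_deriv ?_
    simp only [Complex.mul_re, Complex.mul_im]; ring
  · refine ((g2.mul f1).sub (g1.mul f2)).congr_deriv ?_
    simp only [Complex.mul_re, Complex.mul_im]; ring
  · refine ((f1.pow 2).add (f2.pow 2)).congr_deriv ?_
    simp; ring

theorem aux_mono (p p' : ℝ → ℝ) (hp : ∀ t, HasDerivAt p (p' t) t) (a b : ℝ) (hab : a ≤ b)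
    (h : ∀ t, a < t → t < b → 0 ≤ p' t) : p a ≤ p b := by
  have : MonotoneOn p (Set.Icc a b) := by
    refine monotoneOn_of_deriv_nonneg (convex_Icc a b)
      (fun t _ => (hp t).continuousAt.continuousWithinAt)
      (fun t _ => (hp t).differentiableAt.differentiableWithinAt) ?_
    intro t ht
    rw [interior_Icc] at ht
    rw [(hp t).deriv]
    exact h t ht.1 ht.2
  exact this ⟨le_rfl, hab⟩ ⟨hab, le_rfl⟩ hab

/-- Sector bookkeeping. -/
theorem aux_sector (α β γ : ℝ) (hα : 0 ≤ α) (hβ : 0 ≤ β) (h : α * β < 1)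
    (hγ : α + β ≤ γ * (1 - α * β)) (z w : ℂ) (hz : 0 < z.re) (hw : 0 < w.re)
    (hz' : |z.im| ≤ α * z.re) (hw' : |w.im| ≤ β * w.re) :
    0 < (z * w).re ∧ |(z * w).im| ≤ γ * (z * w).re := by
  have h1 : |z.im * w.im| ≤ α * β * (z.re * w.re) := by
    rw [abs_mul]
    calc |z.im| * |w.im| ≤ (α * z.re) * (β * w.re) := by gcongr
      _ = _ := by ring
  have h2 : |z.re * w.im| ≤ β * (z.re * w.re) := by
    rw [abs_mul, abs_of_pos hz]
    calc z.re * |w.im| ≤ z.re * (β * w.re) := by gcongr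
      _ = _ := by ring
  have h3 : |z.im * w.re| ≤ α * (z.re * w.re) := by
    rw [abs_mul, abs_of_pos hw]
    calc |z.im| * w.re ≤ (α * z.re) * w.re := by gcongr
      _ = _ := by ring
  have hP : 0 < z.re * w.re := mul_pos hz hw
  have hre : (1 - α * β) * (z.re * w.re) ≤ (z * w).re := by
    rw [Complex.mul_re]; linarith [le_abs_self (z.im * w.im)]
  have hγ0 : 0 ≤ γ := by
    by_contra hc
    push Not at hc
    nlinarith
  refine ⟨lt_of_lt_of_le (mul_pos (by linarith) hP) hre, ?_⟩
  calc |(z * w).im| ≤ |z.re * w.im| + |z.im * w.re| := by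
        rw [Complex.mul_im]; exact abs_add_le _ _
    _ ≤ (α + β) * (z.re * w.re) := by linarith
    _ ≤ γ * (1 - α * β) * (z.re * w.re) := by gcongr
    _ = γ * ((1 - α * β) * (z.re * w.re)) := by ring
    _ ≤ _ := by gcongr

theorem aux_six (b0 b1 b2 b3 d : ℂ)
    (h0 : 0 < b0.re) (h1 : 0 < b1.re) (h2 : 0 < b2.re) (h3 : 0 < b3.re) (hd : 0 < d.re)
    (k0 : |b0.im| ≤ 1 / 10 * b0.re) (k1 : |b1.im| ≤ 1 / 10 * b1.re)
    (k2 : |b2.im| ≤ 1 / 10 * b2.re) (k3 : |b3.im| ≤ 1 / 10 * b3.re)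
    (kd : |d.im| ≤ 1 / 10 * d.re) : 0 < (b0 * b1 * (b2 * b3) * (d * d)).re := by
  have e : ∀ z w : ℂ, 0 < z.re → 0 < w.re → |z.im| ≤ 1 / 10 * z.re → |w.im| ≤ 1 / 10 * w.re →
      0 < (z * w).re ∧ |(z * w).im| ≤ 1 / 4 * (z * w).re := fun z w =>
    aux_sector _ _ _ (by norm_num) (by norm_num) (by norm_num) (by norm_num) z w
  obtain ⟨x1, x2⟩ := e b0 b1 h0 h1 k0 k1
  obtain ⟨y1, y2⟩ := e b2 b3 h2 h3 k2 k3
  obtain ⟨z1, z2⟩ := e d d hd hd kd kd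
  obtain ⟨w1, w2⟩ := aux_sector (1 / 4) (1 / 4) (3 / 5) (by norm_num) (by norm_num) (by norm_num)
    (by norm_num) _ _ x1 y1 x2 y2
  exact (aux_sector (3 / 5) (1 / 4) 1 (by norm_num) (by norm_num) (by norm_num)
    (by norm_num) _ _ w1 z1 w2 z2).1

theorem aux_line (q : ℂ → ℂ) (lam : ℝ) (y : ℂ → ℂ) (hy : Differentiable ℂ y)
    (hode : ∀ z : ℂ, deriv (deriv y) z = (lam : ℂ) ^ 2 * q z * y z) (z d : ℂ) (t : ℝ) :
    HasDerivAt (fun t : ℝ => y (z + t * d)) (deriv y (z + t * d) * d) t ∧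
    HasDerivAt (fun t : ℝ => deriv y (z + t * d) * d)
      ((lam : ℂ) ^ 2 * (q (z + t * d) * (d * d)) * y (z + t * d)) t := by
  have hy' : Differentiable ℂ (deriv y) := by
    have := hy.contDiff (n := 2)
    exact (this.differentiable_deriv_two)
  have hl : HasDerivAt (fun t : ℝ => z + (t : ℂ) * d) d t := by
    have := ((Complex.ofRealCLM.hasDerivAt (x := t)).mul_const d).const_add z
    simpa using this
  constructor
  · exact (hy _).hasDerivAt.comp t hl
  · have := ((hy' _).hasDerivAt.comp t hl).mul_const d
    refine this.congr_deriv ?_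
    rw [hode]; ring

theorem aux_right (a₀ a₁ a₂ a₃ : ℝ) (h0 : a₀ ≤ a₃) (h1 : a₁ ≤ a₃) (h2 : a₂ ≤ a₃)
    (q : ℂ → ℂ)
    (hq : ∀ z : ℂ, q z = (z - (a₀ : ℂ)) * (z - (a₁ : ℂ)) * (z - (a₂ : ℂ)) * (z - (a₃ : ℂ)))
    (lam : ℝ) (y : ℂ → ℂ) (he : IsEigen q lam y) (z : ℂ)
    (hz : a₃ < z.re) (hz' : |z.im| < 1 / 10 * (z.re - a₃)) : y z ≠ 0 := by
  obtain ⟨hl, hy, ⟨w, hw⟩, hode, hInt⟩ := he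
  -- the real ray
  set f : ℝ → ℂ := fun t => y t with hfdef
  set g : ℝ → ℂ := fun t => deriv y t with hgdef
  set Q : ℝ → ℂ := fun t => (((lam ^ 2 * ((t - a₀) * (t - a₁) * (t - a₂) * (t - a₃)) : ℝ)) : ℂ)
    with hQdef
  have hf : ∀ t, HasDerivAt f (g t) t := fun t => by
    simpa using (aux_line q lam y hy hode 0 1 t).1
  have hg : ∀ t, HasDerivAt g (Q t * f t) t := fun t => by
    have := (aux_line q lam y hy hode 0 1 t).2
    simp only [zero_add, mul_one] at this
    refine this.congr_deriv ?_
    simp only [hQdef, hfdef, hq]; push_cast; ring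
  have hD := aux_derivs f g Q hf hg
  have hQre : ∀ t, a₃ < t → 0 ≤ (Q t).re := fun t ht => by
    simp only [hQdef, Complex.ofReal_re]
    have := sub_pos.2 ht
    have e0 : 0 ≤ t - a₀ := by linarith
    have e1 : 0 ≤ t - a₁ := by linarith
    have e2 : 0 ≤ t - a₂ := by linarith
    positivity
  have hQim : ∀ t, (Q t).im = 0 := fun t => Complex.ofReal_im _
  set p : ℝ → ℝ := fun t => (g t).re * (f t).re + (g t).im * (f t).im with hp
  set c : ℝ → ℝ := fun t => (g t).im * (f t).re - (g t).re * (f t).im with hc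
  set m : ℝ → ℝ := fun t => (f t).re ^ 2 + (f t).im ^ 2 with hm
  have hpmono : ∀ s t, a₃ < s → s ≤ t → p s ≤ p t := fun s t hs hst =>
    aux_mono p _ (fun t => (hD t).1) s t hst (fun u hu _ => by
      have := hQre u (hs.trans hu)
      positivity)
  have hneg : ∀ s, a₃ < s → p s < 0 := by
    intro s hs
    by_contra hcon
    push Not at hcon
    have hmm : ∀ u t, s ≤ u → u ≤ t → m u ≤ m t := fun u t hu hut =>
      aux_mono m _ (fun t => (hD t).2.2) u t hut (fun v hv _ => by
        have := hpmono s v hs (by linarith)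
        have : 0 ≤ p v := by linarith
        simpa [hp] using this)
    have hex : ∃ u, s ≤ u ∧ f u ≠ 0 := by
      by_contra hno
      push Not at hno
      have han : AnalyticOnNhd ℂ y Set.univ := fun x _ => hy.analyticAt x
      have hfr : ∃ᶠ x in 𝓝[≠] (((s + 1 : ℝ)) : ℂ), y x = (0 : ℂ → ℂ) x := by
        have hev : ∃ᶠ x in 𝓝[≠] (s + 1), f x = 0 := by
          refine Eventually.frequently ?_
          refine eventually_nhdsWithin_of_eventually_nhds ?_
          filter_upwards [lt_mem_nhds (show s < s + 1 by linarith)] with x hx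
          exact hno x hx.le
        have ht : Tendsto (fun x : ℝ => (x : ℂ)) (𝓝[≠] (s + 1)) (𝓝[≠] (((s + 1 : ℝ)) : ℂ)) := by
          refine tendsto_nhdsWithin_of_tendsto_nhds_of_eventually_within _
            (Complex.continuous_ofReal.continuousAt.mono_left nhdsWithin_le_nhds) ?_
          filter_upwards [self_mem_nhdsWithin] with x hx
          exact fun h => hx (Complex.ofReal_injective h)
        exact ht.frequently hev
      have := han.eq_of_frequently_eq (fun x _ => analyticAt_const (v := (0 : ℂ))) hfr
      exact hw (by rw [this])
    obtain ⟨u, hu, hfu⟩ := hex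
    have hmu : 0 < m u := by
      have := Complex.normSq_pos.2 hfu
      rw [Complex.normSq_apply] at this
      simp only [hm]; nlinarith
    have hI : IntegrableOn (fun x : ℝ => ‖y (x : ℂ)‖ ^ 2) (Set.Ioi u) := hInt.integrableOn
    have hI2 : IntegrableOn (fun _ : ℝ => m u) (Set.Ioi u) := by
      refine Integrable.mono' hI aestronglyMeasurable_const ?_
      refine (ae_restrict_iff' measurableSet_Ioi).2 (Eventually.of_forall fun x hx => ?_)
      rw [Real.norm_of_nonneg hmu.le]
      have e := hmm u x hu (le_of_lt hx)
      rw [← Complex.normSq_eq_norm_sq, Complex.normSq_apply]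
      simp only [hm, hfdef] at e ⊢
      linarith
    rw [integrableOn_const_iff] at hI2
    rcases hI2 with h | h
    · exact hmu.ne' (by simpa using h)
    · simp at h
  have hmanti : ∀ s t, a₃ < s → s ≤ t → m t ≤ m s := fun s t hs hst => by
    have := aux_mono (fun t => - m t) _ (fun t => (hD t).2.2.neg) s t hst (fun v hv _ => by
      have := hneg v (hs.trans hv)
      simp only [hp] at this
      linarith)
    simpa using this
  have hcc : ∀ s t, s ≤ t → c s = c t := fun s t hst => by
    apply le_antisymm
    · exact aux_mono c _ (fun t => (hD t).2.1) s t hst (fun v _ _ => by simp [hQim])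
    · have := aux_mono (fun t => - c t) _ (fun t => (hD t).2.1.neg) s t hst
        (fun v _ _ => by simp [hQim])
      simpa using this
  have hc0 : ∀ s, a₃ < s → c s = 0 := by
    intro s hs
    by_contra hne
    have hms : 0 < m s := by
      have h0 : 0 ≤ m s := by simp only [hm]; positivity
      rcases h0.eq_or_lt with h | h
      · exfalso
        have e1 : (f s).re = 0 := by simp only [hm] at h; nlinarith [sq_nonneg (f s).re, sq_nonneg (f s).im]
        have e2 : (f s).im = 0 := by simp only [hm] at h; nlinarith [sq_nonneg (f s).re, sq_nonneg (f s).im]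
        apply hne; simp [hc, e1, e2]
      · exact h
    set k := c s ^ 2 / m s with hk
    have hkpos : 0 < k := by positivity
    have hps := hneg s hs
    set T := s + (- p s) / k with hT
    have hTs : s ≤ T := by
      have : 0 ≤ (- p s) / k := div_nonneg (by linarith) hkpos.le
      linarith
    have := aux_mono (fun t => p t - k * t) _
      (fun t => (hD t).1.sub ((hasDerivAt_id t).const_mul k)) s T hTs (fun v hv _ => by
      have hq0 := hQre v (hs.trans hv)
      have hcv : c s = c v := hcc s v hv.le
      have hmv : m v ≤ m s := hmanti s v hs hv.le
      have hG : c v ^ 2 ≤ ((g v).re ^ 2 + (g v).im ^ 2) * m v := by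
        simp only [hc, hm]
        nlinarith [sq_nonneg ((g v).re * (f v).re + (g v).im * (f v).im)]
      have hG2 : k ≤ (g v).re ^ 2 + (g v).im ^ 2 := by
        rw [hk, div_le_iff₀ hms, hcv]
        exact hG.trans (by gcongr)
      have : 0 ≤ (Q v).re * ((f v).re ^ 2 + (f v).im ^ 2) := by positivity
      linarith)
    have hTn := hneg T (by linarith)
    have : k * T = k * s - p s := by
      rw [hT]; field_simp; ring
    linarith
  -- the segment from `z` to the real axis
  intro hyz
  set μ := z.re - a₃ with hμ
  have hμ0 : 0 < μ := by linarith
  set d : ℂ := ⟨μ, -z.im⟩ with hd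
  have hL := aux_line q lam y hy hode z d
  have hS := aux_derivs (fun t : ℝ => y (z + t * d)) (fun t : ℝ => deriv y (z + t * d) * d)
    (fun t : ℝ => (lam : ℂ) ^ 2 * (q (z + t * d) * (d * d))) (fun t => (hL t).1)
    (fun t => (hL t).2)
  have hfin := aux_mono _ _ (fun t => (hS t).1) 0 1 zero_le_one (fun t ht0 ht1 => by
    have key : ∀ a : ℝ, a ≤ a₃ → 0 < (z + t * d - a).re ∧
        |(z + t * d - a).im| ≤ 1 / 10 * (z + t * d - a).re := fun a ha => by
      have e1 : (z + t * d - a).re = z.re + t * μ - a := by simp [hd]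
      have e2 : (z + t * d - a).im = (1 - t) * z.im := by simp [hd]; ring
      have e3 : 0 < t * μ := by positivity
      rw [e1, e2, abs_mul, abs_of_pos (by linarith : (0 : ℝ) < 1 - t)]
      refine ⟨by linarith, ?_⟩
      have : (1 - t) * |z.im| ≤ 1 * |z.im| := by gcongr; linarith
      linarith
    obtain ⟨r0, i0⟩ := key a₀ h0
    obtain ⟨r1, i1⟩ := key a₁ h1
    obtain ⟨r2, i2⟩ := key a₂ h2
    obtain ⟨r3, i3⟩ := key a₃ le_rfl
    have h6 := aux_six _ _ _ _ d r0 r1 r2 r3 hμ0 i0 i1 i2 i3 (by simpa [hd] using hz'.le)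
    have : 0 ≤ ((lam : ℂ) ^ 2 * (q (z + t * d) * (d * d))).re := by
      rw [hq, ← Complex.ofReal_pow, Complex.re_ofReal_mul]
      refine mul_nonneg (sq_nonneg _) ?_
      refine h6.le.trans_eq ?_
      congr 1; ring
    positivity)
  have hend : z + ((1 : ℝ) : ℂ) * d = ((z.re + μ : ℝ) : ℂ) := by
    apply Complex.ext <;> simp [hd]
  have hx1 : a₃ < z.re + μ := by linarith
  have hA := hneg _ hx1
  have hB := hc0 _ hx1
  simp only [hend] at hfin
  simp only [Complex.ofReal_zero, zero_mul, add_zero, hyz, Complex.zero_re, Complex.zero_im,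
    mul_zero, Complex.mul_re, Complex.mul_im, hd] at hfin
  simp only [hp, hc, hfdef, hgdef] at hA hB
  have hB2 := congrArg (fun t => z.im * t) hB
  have hA2 := mul_neg_of_pos_of_neg hμ0 hA
  simp only [mul_zero] at hB2
  linarith

/-- For a double-well quartic potential, eigenfunctions eventually have no zeros
near any compact subset of the outer forbidden region `(−∞,a₀) ∪ (a₃,∞)`. -/
theorem double_well_no_zeros_near_outer_forbidden_region
    (a₀ a₁ a₂ a₃ : ℝ) (h01 : a₀ < a₁) (h12 : a₁ < a₂) (h23 : a₂ < a₃)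
    (q : ℂ → ℂ)
    (hq : ∀ z : ℂ, q z = (z - (a₀ : ℂ)) * (z - (a₁ : ℂ)) * (z - (a₂ : ℂ)) * (z - (a₃ : ℂ)))
    (lam : ℕ → ℝ) (y : ℕ → ℂ → ℂ)
    (hlam : Tendsto lam atTop atTop)
    (heig : ∀ n, IsEigen q (lam n) (y n))
    (K : Set ℝ) (hK : IsCompact K)
    (hKsub : K ⊆ Set.Iio a₀ ∪ Set.Ioi a₃) :
    ∃ V : Set ℂ, IsOpen V ∧ (∀ x ∈ K, (x : ℂ) ∈ V) ∧
      ∃ N : ℕ, ∀ n ≥ N, ∀ z ∈ V, y n z ≠ 0 := by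
  have hL : ∀ n, IsEigen (fun z => q (-z)) (lam n) (fun z => y n (-z)) := by
    intro n
    obtain ⟨hl, hy, ⟨w, hw⟩, hode, hInt⟩ := heig n
    refine ⟨hl, hy.comp differentiable_neg, ⟨-w, by simpa using hw⟩, fun z => ?_, ?_⟩
    · have e : deriv (fun z => y n (-z)) = fun z => - deriv (y n) (-z) := by
        funext z; exact deriv_comp_neg _ _
      rw [e, deriv.fun_neg, deriv_comp_neg (deriv (y n)), hode]
      ring
    · have := hInt.comp_neg
      simpa using this
  refine ⟨{z : ℂ | a₃ < z.re ∧ |z.im| < 1 / 10 * (z.re - a₃)} ∪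
    {z : ℂ | z.re < a₀ ∧ |z.im| < 1 / 10 * (a₀ - z.re)}, ?_, ?_, 0, ?_⟩
  · apply IsOpen.union
    · exact (isOpen_lt continuous_const Complex.continuous_re).inter
        (isOpen_lt Complex.continuous_im.abs
          (continuous_const.mul (Complex.continuous_re.sub continuous_const)))
    · exact (isOpen_lt Complex.continuous_re continuous_const).inter
        (isOpen_lt Complex.continuous_im.abs
          (continuous_const.mul (continuous_const.sub Complex.continuous_re)))
  · intro x hx
    rcases hKsub hx with h | h
    · right
      have h' : x < a₀ := h
      refine ⟨by simpa using h', ?_⟩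
      simp; linarith
    · left
      have h' : a₃ < x := h
      refine ⟨by simpa using h', ?_⟩
      simp; linarith
  · intro n _ z hz
    rcases hz with ⟨h, h'⟩ | ⟨h, h'⟩
    · exact aux_right a₀ a₁ a₂ a₃ (by linarith) (by linarith) (by linarith) q hq _ _ (heig n) z h h'
    · have := aux_right (-a₃) (-a₂) (-a₁) (-a₀) (by linarith) (by linarith) (by linarith)
        (fun z => q (-z)) (fun z => by rw [hq]; push_cast; ring) _ _ (hL n) (-z)
        (by simpa using h) (by simp; linarith)
      simpa using this
end
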